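/- arXiv:1011.6441 — 2 statements merged into one kernel-verified Lean document; each statement's English description precedes it below -/
import Mathlib

section
/- Minimum Hamming distance of repetition permutation codes. Let η ≥ 1, ν ≥ 2, n = ην, and let s₁,…,s_η ∈ ℝ^ν each have pairwise distinct entries. The repetition permutation code of repetition order η is the set of vectors ((Y s₁)ᵀ, (Y s₂)ᵀ, …, (Y s_η)ᵀ)ᵀ ∈ ℝⁿ as Y ranges over all ν×ν permutation matrices. Then the minimum Hamming distance of this code is exactly 2η: any two codewords arising from distinct permutation matrices Y ≠ Y' differ in at least 2η coordinates, and some pair of distinct codewords differs in exactly 2η coordinates. -/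
open Matrix Finset

/-- A permutation matrix: entries lie in `{0, 1}` and every row sum and column sum is `1`. -/
def IsPermMatrix {n : ℕ} (X : Matrix (Fin n) (Fin n) ℝ) : Prop :=
  (∀ i j, X i j = 0 ∨ X i j = 1) ∧ (∀ i, ∑ j, X i j = 1) ∧ (∀ j, ∑ i, X i j = 1)

/-- The matrix of a permutation is a permutation matrix. -/
theorem isPermMatrix_permMatrix {n : ℕ} (σ : Equiv.Perm (Fin n)) :
    IsPermMatrix (σ.permMatrix ℝ) := by
  refine ⟨fun i j => ?_, fun i => ?_, fun j => ?_⟩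
  · by_cases h : σ i = j <;> simp [Equiv.Perm.permMatrix, PEquiv.toMatrix_apply, h]
  · simp
  · simp [← Equiv.eq_symm_apply]

/-- Every permutation matrix is the matrix of a permutation. -/
theorem IsPermMatrix.exists_perm {n : ℕ} {X : Matrix (Fin n) (Fin n) ℝ} (hX : IsPermMatrix X) :
    ∃ σ : Equiv.Perm (Fin n), X = σ.permMatrix ℝ := by
  obtain ⟨h01, hrow, hcol⟩ := hX
  have hnonneg : ∀ i j, 0 ≤ X i j := fun i j => by rcases h01 i j with h | h <;> simp [h]
  have hex : ∀ i, ∃ j, X i j = 1 := fun i => by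
    by_contra! h
    have hzero : ∑ j, X i j = 0 := sum_eq_zero fun j _ => (h01 i j).resolve_right (h j)
    linarith [hrow i]
  choose f hf using hex
  have hinj : Function.Injective f := fun a b hab => by
    by_contra hne
    have hle : ∑ i ∈ {a, b}, X i (f a) ≤ ∑ i, X i (f a) :=
      sum_le_sum_of_subset_of_nonneg (subset_univ _) fun i _ _ => hnonneg i _
    rw [sum_pair hne, hcol, hf a, hab, hf b] at hle
    linarith
  refine ⟨Equiv.ofBijective f hinj.bijective_of_finite, ?_⟩
  ext i j
  by_cases hj : f i = j
  · simp [Equiv.Perm.permMatrix, PEquiv.toMatrix_apply, ← hj, hf]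
  · have hle : ∑ k ∈ {f i, j}, X i k ≤ ∑ k, X i k :=
      sum_le_sum_of_subset_of_nonneg (subset_univ _) fun k _ _ => hnonneg i k
    rw [sum_pair hj, hrow, hf] at hle
    have hzero : X i j = 0 := by linarith [hnonneg i j]
    simp [Equiv.Perm.permMatrix, PEquiv.toMatrix_apply, hzero, hj]

/-- The Hamming distance between the codewords of `σ` and `τ` is `η` times the number of points
moved by `τ⁻¹ * σ`. -/
theorem card_mulVec_permMatrix_ne {η ν : ℕ} {s : Fin η → Fin ν → ℝ}
    (hs : ∀ k, Function.Injective (s k)) (σ τ : Equiv.Perm (Fin ν)) :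
    Nat.card {p : Fin η × Fin ν //
      (σ.permMatrix ℝ).mulVec (s p.1) p.2 ≠ (τ.permMatrix ℝ).mulVec (s p.1) p.2} =
      η * (τ⁻¹ * σ).support.card := by
  have hset : ∀ p : Fin η × Fin ν,
      (σ.permMatrix ℝ).mulVec (s p.1) p.2 ≠ (τ.permMatrix ℝ).mulVec (s p.1) p.2 ↔
        p ∈ (univ : Finset (Fin η)) ×ˢ (τ⁻¹ * σ).support := fun p => by
    simp [Matrix.permMatrix_mulVec, (hs p.1).eq_iff, Equiv.symm_apply_eq]
  rw [Nat.card_congr (Equiv.subtypeEquivRight hset), Nat.card_eq_fintype_card, Fintype.card_coe,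
    card_product, card_univ, Fintype.card_fin]

/-- The minimum Hamming distance of the repetition permutation code of repetition order
`η` (codewords `((Y s₁)ᵀ, …, (Y s_η)ᵀ)ᵀ`, `Y` ranging over `ν × ν` permutation matrices,
each `s_k` having pairwise distinct entries) is exactly `2η`. -/
theorem stmt12 (η ν : ℕ) (hη : 1 ≤ η) (hν : 2 ≤ ν)
    (s : Fin η → Fin ν → ℝ) (hs : ∀ k, Function.Injective (s k)) :
    (∀ Y Y' : Matrix (Fin ν) (Fin ν) ℝ, IsPermMatrix Y → IsPermMatrix Y' → Y ≠ Y' →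
      2 * η ≤ Nat.card {p : Fin η × Fin ν //
        Y.mulVec (s p.1) p.2 ≠ Y'.mulVec (s p.1) p.2}) ∧
    (∃ Y Y' : Matrix (Fin ν) (Fin ν) ℝ, IsPermMatrix Y ∧ IsPermMatrix Y' ∧ Y ≠ Y' ∧
      Nat.card {p : Fin η × Fin ν //
        Y.mulVec (s p.1) p.2 ≠ Y'.mulVec (s p.1) p.2} = 2 * η) := by
  constructor
  · intro Y Y' hY hY' hne
    obtain ⟨σ, rfl⟩ := hY.exists_perm
    obtain ⟨τ, rfl⟩ := hY'.exists_perm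
    have hστ : τ⁻¹ * σ ≠ 1 := fun h => hne (by rw [inv_mul_eq_one.mp h])
    rw [card_mulVec_permMatrix_ne hs, mul_comm]
    exact Nat.mul_le_mul_left η (Equiv.Perm.two_le_card_support_of_ne_one hστ)
  · have h01 : (⟨0, by omega⟩ : Fin ν) ≠ ⟨1, by omega⟩ := by simp
    set σ : Equiv.Perm (Fin ν) := Equiv.swap ⟨0, by omega⟩ ⟨1, by omega⟩ with hσ
    have hcard : Nat.card {p : Fin η × Fin ν // (σ.permMatrix ℝ).mulVec (s p.1) p.2 ≠
        ((1 : Equiv.Perm (Fin ν)).permMatrix ℝ).mulVec (s p.1) p.2} = 2 * η := by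
      rw [card_mulVec_permMatrix_ne hs, inv_one, one_mul, hσ,
        Equiv.Perm.card_support_swap h01, mul_comm]
    refine ⟨_, _, isPermMatrix_permMatrix σ, isPermMatrix_permMatrix 1, fun h => ?_, hcard⟩
    simp only [h, ne_eq, not_true_eq_false, Nat.card_of_isEmpty] at hcard
    omega
end

section
/- Average cardinality of random LP decodable permutation codes. Let n ≥ 2 and m ≥ 0. Let 𝒫 denote the family of 2-element subsets of the position set {1,…,n}×{1,…,n}, and for a function f : {1,…,m} → 𝒫 let M(f) be the number of n×n permutation matrices X such that for every r ∈ {1,…,m} the two entries of X at the two positions of f(r) are equal. Then Σ over all functions f : {1,…,m} → 𝒫 of M(f) equals n! · ( C(n,2) + C(n²−n, 2) )^m. Equivalently, under the uniform distribution on such constraint functions, the expected cardinality of the resulting code is n! · ( (C(n,2) + C(n²−n,2)) / C(n²,2) )^m. -/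
open Matrix Finset

/-- The real `0`-`1` matrix of the graph of a permutation. -/
def graphMatrix {n : ℕ} (σ : Equiv.Perm (Fin n)) : Matrix (Fin n) (Fin n) ℝ :=
  fun i j => if σ i = j then 1 else 0

theorem graphMatrix_injective {n : ℕ} : Function.Injective (graphMatrix (n := n)) := by
  intro σ τ h
  ext i
  have h1 := congrFun (congrFun h i) (σ i)
  by_contra hne
  have : τ i ≠ σ i := fun h => hne (by rw [h])
  simp [graphMatrix, this] at h1

theorem isPermMatrix_graphMatrix {n : ℕ} (σ : Equiv.Perm (Fin n)) :
    IsPermMatrix (graphMatrix σ) := by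
  refine ⟨fun i j => ?_, fun i => ?_, fun j => ?_⟩
  · unfold graphMatrix
    split_ifs <;> simp
  · simp [graphMatrix]
  · simp [graphMatrix, ← Equiv.eq_symm_apply]

theorem eq_of_sum_eq_one_of_eq_one {ι : Type*} [Fintype ι] {x : ι → ℝ}
    (hx : ∀ i, x i = 0 ∨ x i = 1) (hsum : ∑ i, x i = 1) {i j : ι}
    (hi : x i = 1) (hj : x j = 1) : i = j := by
  classical
  by_contra hij
  have h : ∑ k ∈ ({i, j} : Finset ι), x k ≤ ∑ k, x k :=
    Finset.sum_le_sum_of_subset_of_nonneg (Finset.subset_univ _) fun k _ _ => by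
      rcases hx k with h | h <;> simp [h]
  rw [Finset.sum_pair hij, hi, hj, hsum] at h
  norm_num at h

theorem exists_graphMatrix_eq {n : ℕ} {X : Matrix (Fin n) (Fin n) ℝ} (hX : IsPermMatrix X) :
    ∃ σ, graphMatrix σ = X := by
  obtain ⟨h01, hrow, hcol⟩ := hX
  have hex : ∀ i, ∃ j, X i j = 1 := by
    intro i
    by_contra! h
    have h0 : ∑ j, X i j = 0 := Finset.sum_eq_zero fun j _ => (h01 i j).resolve_right (h j)
    rw [hrow i] at h0
    exact one_ne_zero h0
  choose g hg using hex
  have hinj : Function.Injective g := fun i k hik =>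
    eq_of_sum_eq_one_of_eq_one (x := fun i => X i (g k)) (fun i => h01 i _) (hcol _)
      (by rw [← hik]; exact hg i) (hg k)
  refine ⟨Equiv.ofBijective g (Finite.injective_iff_bijective.1 hinj), ?_⟩
  ext i j
  by_cases hj : g i = j
  · simp [graphMatrix, hj, ← hg i]
  · have h0 : X i j = 0 := (h01 i j).resolve_right fun h1 =>
      hj (eq_of_sum_eq_one_of_eq_one (h01 i) (hrow i) (hg i) h1)
    simp [graphMatrix, hj, h0]

/-- Permutation matrices with a given property correspond to permutations. -/
theorem card_isPermMatrix {n : ℕ} (C : Matrix (Fin n) (Fin n) ℝ → Prop) :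
    Nat.card {X : Matrix (Fin n) (Fin n) ℝ // IsPermMatrix X ∧ C X} =
      Nat.card {σ : Equiv.Perm (Fin n) // C (graphMatrix σ)} := by
  refine (Nat.card_congr (Equiv.ofBijective
    (fun σ => ⟨graphMatrix σ.1, isPermMatrix_graphMatrix σ.1, σ.2⟩) ⟨?_, ?_⟩)).symm
  · intro σ τ h
    exact Subtype.ext (graphMatrix_injective (congrArg Subtype.val h))
  · rintro ⟨X, hX, hC⟩
    obtain ⟨σ, rfl⟩ := exists_graphMatrix_eq hX
    exact ⟨⟨σ, hC⟩, rfl⟩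

/-- The pairs that do not separate `S` from its complement. -/
theorem card_pairs_not_separating {α : Type*} [Fintype α] [DecidableEq α] (S : Finset α) :
    Nat.card {P : {P : Finset α // P.card = 2} // ∀ p ∈ P.1, ∀ q ∈ P.1, (p ∈ S ↔ q ∈ S)} =
      S.card.choose 2 + (Fintype.card α - S.card).choose 2 := by
  have hdisj : Disjoint (powersetCard 2 S) (powersetCard 2 Sᶜ) := by
    rw [Finset.disjoint_left]
    intro P h1 h2
    rw [mem_powersetCard] at h1 h2
    obtain ⟨p, hp⟩ : P.Nonempty := Finset.card_pos.1 (by omega)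
    exact Finset.mem_compl.1 (h2.1 hp) (h1.1 hp)
  rw [← Finset.card_compl, ← Finset.card_powersetCard, ← Finset.card_powersetCard,
    ← Finset.card_union_of_disjoint hdisj, ← Nat.card_eq_finsetCard]
  refine Nat.card_congr ((Equiv.subtypeSubtypeEquivSubtypeInter (fun P : Finset α => P.card = 2)
    (fun P => ∀ p ∈ P, ∀ q ∈ P, (p ∈ S ↔ q ∈ S))).trans
      (Equiv.subtypeEquivRight fun P => ?_))
  simp only [mem_union, mem_powersetCard]
  constructor
  · rintro ⟨hc, h⟩
    obtain ⟨p, hp⟩ : P.Nonempty := Finset.card_pos.1 (by omega)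
    by_cases hS : p ∈ S
    · exact Or.inl ⟨fun q hq => (h p hp q hq).1 hS, hc⟩
    · exact Or.inr ⟨fun q hq => Finset.mem_compl.2 fun hqS => hS ((h p hp q hq).2 hqS), hc⟩
  · rintro (⟨h, hc⟩ | ⟨h, hc⟩)
    · exact ⟨hc, fun p hp q hq => iff_of_true (h hp) (h hq)⟩
    · exact ⟨hc, fun p hp q hq =>
        iff_of_false (Finset.mem_compl.1 (h hp)) (Finset.mem_compl.1 (h hq))⟩

theorem card_graph {n : ℕ} (σ : Equiv.Perm (Fin n)) :
    (univ.filter fun p : Fin n × Fin n => σ p.1 = p.2).card = n := by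
  have h : (univ.filter fun p : Fin n × Fin n => σ p.1 = p.2) =
      univ.image fun i => (i, σ i) := by
    ext ⟨i, j⟩
    simp
  rw [h, Finset.card_image_of_injective _ fun i j hij => congrArg Prod.fst hij]
  simp

theorem card_pairs_graphMatrix_eq {n : ℕ} (σ : Equiv.Perm (Fin n)) :
    Nat.card {P : {P : Finset (Fin n × Fin n) // P.card = 2} //
      ∀ p ∈ P.1, ∀ q ∈ P.1, graphMatrix σ p.1 p.2 = graphMatrix σ q.1 q.2} =
      n.choose 2 + (n ^ 2 - n).choose 2 := by
  have h := card_pairs_not_separating (univ.filter fun p : Fin n × Fin n => σ p.1 = p.2)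
  rw [card_graph, Fintype.card_prod, Fintype.card_fin, ← sq] at h
  rw [← h]
  refine Nat.card_congr (Equiv.subtypeEquivRight fun P => ?_)
  refine forall₄_congr fun p _ q _ => ?_
  by_cases hp : σ p.1 = p.2 <;> by_cases hq : σ q.1 = q.2 <;> simp [graphMatrix, hp, hq]

/-- Average cardinality of random LP decodable permutation codes: summing, over all
assignments `f` of a 2-element set of positions to each of the `m` random equality
constraints, the number `M(f)` of permutation matrices whose entries agree on each
constrained pair, yields `n! · (C(n,2) + C(n²−n,2))^m`. -/
theorem stmt14 (n m : ℕ) (hn : 2 ≤ n) :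
    ∑ f : Fin m → {P : Finset (Fin n × Fin n) // P.card = 2},
      Nat.card {X : Matrix (Fin n) (Fin n) ℝ // IsPermMatrix X ∧
        ∀ r : Fin m, ∀ p ∈ (f r).1, ∀ q ∈ (f r).1, X p.1 p.2 = X q.1 q.2}
    = n.factorial * (n.choose 2 + (n ^ 2 - n).choose 2) ^ m := by
  classical
  simp_rw [card_isPermMatrix]
  have hfiber (σ : Equiv.Perm (Fin n)) :
      Nat.card {f : Fin m → {P : Finset (Fin n × Fin n) // P.card = 2} //
        ∀ r : Fin m, ∀ p ∈ (f r).1, ∀ q ∈ (f r).1,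
          graphMatrix σ p.1 p.2 = graphMatrix σ q.1 q.2} =
        (n.choose 2 + (n ^ 2 - n).choose 2) ^ m := by
    rw [← card_pairs_graphMatrix_eq σ, Nat.card_congr (Equiv.subtypePiEquivPi
      (p := fun _ (P : {P : Finset (Fin n × Fin n) // P.card = 2}) =>
        ∀ p ∈ P.1, ∀ q ∈ P.1, graphMatrix σ p.1 p.2 = graphMatrix σ q.1 q.2)), Nat.card_pi]
    simp only [prod_const, card_univ, Fintype.card_fin]
  calc
    _ = ∑ σ : Equiv.Perm (Fin n),
        Nat.card {f : Fin m → {P : Finset (Fin n × Fin n) // P.card = 2} //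
          ∀ r : Fin m, ∀ p ∈ (f r).1, ∀ q ∈ (f r).1,
            graphMatrix σ p.1 p.2 = graphMatrix σ q.1 q.2} := by
      simp only [Nat.card_eq_fintype_card, Fintype.card_subtype]
      exact sum_card_bipartiteAbove_eq_sum_card_bipartiteBelow _
    _ = _ := by
      simp only [hfiber, sum_const, card_univ, Fintype.card_perm, Fintype.card_fin, smul_eq_mul]
end
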